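/- arXiv:1207.4013 — 6 statements merged into one kernel-verified Lean document; each statement's English description precedes it below -/
import Mathlib

section
/- In the abstract setting, let X ∈ 𝒦^p satisfy D X = 0. Then the class [X] ∈ ℰ^p lies in b(ℰ^p) if and only if X_0 ∈ I^p + d(K^{p−1}). -/
/-! Abstract setting for the paper's relative Brieskorn complexes.

`Ω` is a cochain complex of `R`-modules, graded by `ℤ` and vanishing in
negative degrees (this encodes the paper's conventions `Ω^p` for `p ∈ ℕ`,
`K^{-1} := 0`, `I^0 := 0`, `𝒦^{-1} := 0`), with two anticommuting
differentials `d` (the relative de Rham differential) and `e` (exterior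
multiplication by `d_{/S} f`). -/

section AbstractSetting

variable {R : Type*} [CommRing R] {Ω : ℤ → Type*}
  [∀ i, AddCommGroup (Ω i)] [∀ i, Module R (Ω i)]

/-- The space `𝒦^p` of formal series `Σ_j b^j ω_j` with `e(ω_0) = 0`,
as a submodule of the module of sequences `ℕ → Ω p`. -/
def KSeq (e : ∀ i : ℤ, Ω i →ₗ[R] Ω (i + 1)) (p : ℤ) :
    Submodule R (ℕ → Ω p) where
  carrier := {ω | e p (ω 0) = 0}
  add_mem' := by
    intro x y hx hy
    simp only [Set.mem_setOf_eq, Pi.add_apply, map_add] at *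
    rw [hx, hy, add_zero]
  zero_mem' := by simp
  smul_mem' := by
    intro c x hx
    simp only [Set.mem_setOf_eq, Pi.smul_apply, map_smul] at *
    rw [hx, smul_zero]

/-- The differential `D` on sequences: `(D ω)_j = d(ω_j) - e(ω_{j+1})`. -/
def Dop (d e : ∀ i : ℤ, Ω i →ₗ[R] Ω (i + 1)) (p : ℤ) :
    (ℕ → Ω p) →ₗ[R] (ℕ → Ω (p + 1)) where
  toFun ω := fun j => d p (ω j) - e p (ω (j + 1))
  map_add' x y := by
    funext j
    simp only [Pi.add_apply, map_add]
    abel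
  map_smul' c x := by
    funext j
    simp only [Pi.smul_apply, map_smul, RingHom.id_apply, smul_sub]

/-- The shift operator `b` on sequences: `(b ω)_0 = 0`, `(b ω)_j = ω_{j-1}`. -/
def bShift {p : ℤ} (ω : ℕ → Ω p) : ℕ → Ω p
  | 0 => 0
  | (k + 1) => ω k

/-- The sequence `(x, 0, 0, …)`, i.e. the chain map `u : K^p → 𝒦^p`. -/
def unitSeq {p : ℤ} (x : Ω p) : ℕ → Ω p
  | 0 => x
  | (_ + 1) => 0

/-- The submodule of finitely supported sequences (`𝒦^{0,p}` inside `𝒦^p`). -/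
def finSuppSeq (p : ℤ) : Submodule R (ℕ → Ω p) where
  carrier := {ω | ∃ N : ℕ, ∀ j : ℕ, N ≤ j → ω j = 0}
  add_mem' := by
    rintro x y ⟨Nx, hx⟩ ⟨Ny, hy⟩
    exact ⟨max Nx Ny, fun j hj => by
      simp [hx j (le_trans (le_max_left _ _) hj), hy j (le_trans (le_max_right _ _) hj)]⟩
  zero_mem' := ⟨0, fun j _ => rfl⟩
  smul_mem' := by
    rintro c x ⟨Nx, hx⟩
    exact ⟨Nx, fun j hj => by simp [hx j hj]⟩

/-- The cocycles `Z^p = K^p ∩ ker d` of the complex `(K^•, d)`. -/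
def Zmod (d e : ∀ i : ℤ, Ω i →ₗ[R] Ω (i + 1)) (p : ℤ) : Submodule R (Ω p) :=
  LinearMap.ker (e p) ⊓ LinearMap.ker (d p)

/-- The coboundaries `d(K^{p-1})` of the complex `(K^•, d)` (in degree `q+1`). -/
def Bmod (d e : ∀ i : ℤ, Ω i →ₗ[R] Ω (i + 1)) (q : ℤ) : Submodule R (Ω (q + 1)) :=
  Submodule.map (d q) (LinearMap.ker (e q))

/-- The cohomology `E^{q+1} = (K^{q+1} ∩ ker d) / d(K^q)`. -/
abbrev Emod (d e : ∀ i : ℤ, Ω i →ₗ[R] Ω (i + 1)) (q : ℤ) :=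
  Zmod d e (q + 1) ⧸ Submodule.comap (Zmod d e (q + 1)).subtype (Bmod d e q)

/-- The `D`-cocycles in `𝒦^p`. -/
def ZSeq (d e : ∀ i : ℤ, Ω i →ₗ[R] Ω (i + 1)) (p : ℤ) : Submodule R (ℕ → Ω p) :=
  KSeq e p ⊓ LinearMap.ker (Dop d e p)

/-- The `D`-coboundaries `D(𝒦^q)` in degree `q+1`. -/
def BSeq (d e : ∀ i : ℤ, Ω i →ₗ[R] Ω (i + 1)) (q : ℤ) : Submodule R (ℕ → Ω (q + 1)) :=
  Submodule.map (Dop d e q) (KSeq e q)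

/-- The cohomology `ℰ^{q+1} = ker(D : 𝒦^{q+1} → 𝒦^{q+2}) / D(𝒦^q)`. -/
abbrev ESeq (d e : ∀ i : ℤ, Ω i →ₗ[R] Ω (i + 1)) (q : ℤ) :=
  ZSeq d e (q + 1) ⧸ Submodule.comap (ZSeq d e (q + 1)).subtype (BSeq d e q)

end AbstractSetting

theorem Dop_Dop {R : Type*} [CommRing R] {Ω : ℤ → Type*}
    [∀ i, AddCommGroup (Ω i)] [∀ i, Module R (Ω i)]
    {d e : ∀ i : ℤ, Ω i →ₗ[R] Ω (i + 1)}
    (hdd : ∀ (i : ℤ) (x : Ω i), d (i + 1) (d i x) = 0)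
    (hee : ∀ (i : ℤ) (x : Ω i), e (i + 1) (e i x) = 0)
    (hde : ∀ (i : ℤ) (x : Ω i), d (i + 1) (e i x) = - e (i + 1) (d i x))
    (q : ℤ) (U : ℕ → Ω q) : Dop d e (q + 1) (Dop d e q U) = 0 := by
  funext j
  simp [Dop, hdd, hee, hde]

/-- A `D`-cocycle with vanishing constant term is `b` times a `D`-cocycle. -/
theorem exists_eq_bShift_of_Dop_eq_zero {R : Type*} [CommRing R] {Ω : ℤ → Type*}
    [∀ i, AddCommGroup (Ω i)] [∀ i, Module R (Ω i)]
    {d e : ∀ i : ℤ, Ω i →ₗ[R] Ω (i + 1)} {p : ℤ} {W : ℕ → Ω p}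
    (hW : Dop d e p W = 0) (hW0 : W 0 = 0) :
    ∃ Y ∈ ZSeq d e p, W = bShift Y := by
  refine ⟨fun j => W (j + 1), ⟨?_, ?_⟩, ?_⟩
  · change e p (W 1) = 0
    have h := congrFun hW 0
    simpa [Dop, hW0] using h
  · exact funext fun j => congrFun hW (j + 1)
  · funext j
    cases j with
    | zero => exact hW0
    | succ k => rfl

/-- paper's Lemma "image de b".
Let `X ∈ 𝒦^p` with `D X = 0` (here `p = q + 1`).  Then the class `[X] ∈ ℰ^p`
lies in `b(ℰ^p)` if and only if `X_0 ∈ I^p + d(K^{p-1})`. -/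
theorem brieskorn_class_mem_b_iff
    {R : Type*} [CommRing R] {Ω : ℤ → Type*}
    [∀ i, AddCommGroup (Ω i)] [∀ i, Module R (Ω i)]
    (hneg : ∀ i : ℤ, i < 0 → Subsingleton (Ω i))
    (d e : ∀ i : ℤ, Ω i →ₗ[R] Ω (i + 1))
    (hdd : ∀ (i : ℤ) (x : Ω i), d (i + 1) (d i x) = 0)
    (hee : ∀ (i : ℤ) (x : Ω i), e (i + 1) (e i x) = 0)
    (hde : ∀ (i : ℤ) (x : Ω i), d (i + 1) (e i x) = - e (i + 1) (d i x))
    (q : ℤ) (X : ℕ → Ω (q + 1)) (hX : X ∈ ZSeq d e (q + 1)) :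
    (∃ Y ∈ ZSeq d e (q + 1), ∃ U ∈ KSeq e q, X = bShift Y + Dop d e q U) ↔
      X 0 ∈ LinearMap.range (e q) ⊔ Submodule.map (d q) (LinearMap.ker (e q)) := by
  constructor
  · rintro ⟨Y, -, U, hU, rfl⟩
    refine Submodule.mem_sup.2 ⟨e q (-U 1), ⟨_, rfl⟩, d q (U 0), ⟨U 0, hU, rfl⟩, ?_⟩
    simp [Dop, bShift, sub_eq_add_neg, add_comm]
  · intro h
    obtain ⟨_, ⟨a, rfl⟩, _, ⟨k, hk, rfl⟩, hak⟩ := Submodule.mem_sup.1 h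
    let U : ℕ → Ω q := fun j => if j = 0 then k else -a
    have hDX : Dop d e (q + 1) X = 0 := hX.2
    obtain ⟨Y, hY, hYX⟩ := exists_eq_bShift_of_Dop_eq_zero (d := d) (e := e)
      (W := X - Dop d e q U)
      (by rw [map_sub, hDX, Dop_Dop hdd hee hde, sub_zero])
      (by simp [Dop, U, ← hak, add_comm])
    exact ⟨Y, hY, U, hk, sub_eq_iff_eq_add.1 hYX⟩
end

section
/- In the abstract setting, assume (Ω^•, d) is exact in positive degrees and let p ≥ 2. Then: (1) every x ∈ K^p ∩ ker d can be written x = d(ξ) with ξ ∈ Ω^{p−1}; (2) for any such ξ one has e(ξ) ∈ K^p ∩ ker d; (3) the class of e(ξ) in E^p depends neither on the choice of ξ with d(ξ) = x nor on the representative x of its class in E^p; (4) the resulting map b : E^p → E^p, b[x] := [e(ξ)], is R-linear. -/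
section ActionOfB

variable {R : Type*} [CommRing R] {Ω : ℤ → Type*}
  [∀ i, AddCommGroup (Ω i)] [∀ i, Module R (Ω i)]
  {d e : ∀ i : ℤ, Ω i →ₗ[R] Ω (i + 1)}

/-- If `d ξ ∈ K^{q+1}`, then `e ξ` is a cocycle of `(K^•, d)`. -/
theorem e_mem_Zmod (hee : ∀ (i : ℤ) (x : Ω i), e (i + 1) (e i x) = 0)
    (hde : ∀ (i : ℤ) (x : Ω i), d (i + 1) (e i x) = - e (i + 1) (d i x))
    {q : ℤ} {ξ : Ω q} (h : e (q + 1) (d q ξ) = 0) :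
    e q ξ ∈ Zmod d e (q + 1) := by
  refine ⟨hee q ξ, ?_⟩
  rw [SetLike.mem_coe, LinearMap.mem_ker, hde, h, neg_zero]

/-- If `d ξ` is a coboundary of `(K^•, d)`, then so is `e ξ`, provided that `Ω` is exact at `ξ`. -/
theorem e_mem_Bmod (hee : ∀ (i : ℤ) (x : Ω i), e (i + 1) (e i x) = 0)
    (hde : ∀ (i : ℤ) (x : Ω i), d (i + 1) (e i x) = - e (i + 1) (d i x))
    {q : ℤ} (hex : ∀ y : Ω (q + 1), d (q + 1) y = 0 → ∃ x : Ω q, d q x = y)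
    {ξ : Ω (q + 1)} (h : d (q + 1) ξ ∈ Bmod d e (q + 1)) :
    e (q + 1) ξ ∈ Bmod d e (q + 1) := by
  obtain ⟨k, hk, hkξ⟩ := h
  obtain ⟨η, hη⟩ := hex (ξ - k) (by rw [map_sub, hkξ, sub_self])
  refine ⟨-e q η, by simp [hee], ?_⟩
  rw [map_neg, hde, neg_neg, hη, map_sub, LinearMap.mem_ker.mp hk, sub_zero]

end ActionOfB

/-- construction of the action of `b` on `E^p`, from the
paper's Lemma "Tilde b" and Definition "b en cohomologie".
Assume `(Ω^•, d)` is exact in positive degrees and `p ≥ 2` (here `p = r + 2`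
with `r ≥ 0`).  Then: (1) every `x ∈ K^p ∩ ker d` can be written `x = d ξ`;
(2) for any such `ξ`, `e ξ ∈ K^p ∩ ker d`; (3) the class of `e ξ` in `E^p`
depends neither on the choice of `ξ` nor on the representative `x`; (4) the
resulting map `b : E^p → E^p`, `b [x] = [e ξ]`, is `R`-linear. -/
theorem brieskorn_b_action_on_cohomology_well_defined
    {R : Type*} [CommRing R] {Ω : ℤ → Type*}
    [∀ i, AddCommGroup (Ω i)] [∀ i, Module R (Ω i)]
    (hneg : ∀ i : ℤ, i < 0 → Subsingleton (Ω i))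
    (d e : ∀ i : ℤ, Ω i →ₗ[R] Ω (i + 1))
    (hdd : ∀ (i : ℤ) (x : Ω i), d (i + 1) (d i x) = 0)
    (hee : ∀ (i : ℤ) (x : Ω i), e (i + 1) (e i x) = 0)
    (hde : ∀ (i : ℤ) (x : Ω i), d (i + 1) (e i x) = - e (i + 1) (d i x))
    (hex : ∀ i : ℤ, 0 ≤ i → ∀ y : Ω (i + 1), d (i + 1) y = 0 →
      ∃ x : Ω i, d i x = y)
    (r : ℤ) (hr : 0 ≤ r) :
    -- (1)
    (∀ x : Ω (r + 1 + 1), x ∈ Zmod d e (r + 1 + 1) → ∃ ξ : Ω (r + 1), d (r + 1) ξ = x) ∧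
    -- (2)
    (∀ x : Ω (r + 1 + 1), x ∈ Zmod d e (r + 1 + 1) → ∀ ξ : Ω (r + 1),
      d (r + 1) ξ = x → e (r + 1) ξ ∈ Zmod d e (r + 1 + 1)) ∧
    -- (3)
    (∀ x x' : Ω (r + 1 + 1), x ∈ Zmod d e (r + 1 + 1) → x' ∈ Zmod d e (r + 1 + 1) →
      ∀ ξ ξ' : Ω (r + 1), d (r + 1) ξ = x → d (r + 1) ξ' = x' →
        x - x' ∈ Bmod d e (r + 1) →
        e (r + 1) ξ - e (r + 1) ξ' ∈ Bmod d e (r + 1)) ∧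
    -- (4)
    (∃ bE : Emod d e (r + 1) →ₗ[R] Emod d e (r + 1),
      ∀ (x : Ω (r + 1 + 1)) (hx : x ∈ Zmod d e (r + 1 + 1)) (ξ : Ω (r + 1))
        (hξ : d (r + 1) ξ = x) (he : e (r + 1) ξ ∈ Zmod d e (r + 1 + 1)),
        bE (Submodule.Quotient.mk ⟨x, hx⟩) =
          Submodule.Quotient.mk ⟨e (r + 1) ξ, he⟩) := by
  have lift (x : Ω (r + 1 + 1)) (hx : x ∈ Zmod d e (r + 1 + 1)) :
      ∃ ξ : Ω (r + 1), d (r + 1) ξ = x :=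
    hex (r + 1) (by lia) x hx.2
  have cocycle (x : Ω (r + 1 + 1)) (hx : x ∈ Zmod d e (r + 1 + 1)) (ξ : Ω (r + 1))
      (hξ : d (r + 1) ξ = x) : e (r + 1) ξ ∈ Zmod d e (r + 1 + 1) :=
    e_mem_Zmod hee hde (hξ ▸ hx.1)
  have coboundary (ξ : Ω (r + 1)) (h : d (r + 1) ξ ∈ Bmod d e (r + 1)) :
      e (r + 1) ξ ∈ Bmod d e (r + 1) :=
    e_mem_Bmod hee hde (hex r hr) h
  refine ⟨lift, cocycle, ?_, ?_⟩
  · rintro x x' - - ξ ξ' rfl rfl h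
    rw [← map_sub] at h ⊢
    exact coboundary _ h
  choose ξ hξ using fun x : Zmod d e (r + 1 + 1) => lift x x.2
  let B := Submodule.comap (Zmod d e (r + 1 + 1)).subtype (Bmod d e (r + 1))
  let b (x : Zmod d e (r + 1 + 1)) : Emod d e (r + 1) :=
    B.mkQ ⟨e (r + 1) (ξ x), cocycle x x.2 _ (hξ x)⟩
  have b_eq (x : Zmod d e (r + 1 + 1)) (z : Zmod d e (r + 1 + 1)) (ζ : Ω (r + 1))
      (hz : e (r + 1) ζ = z) (hζ : d (r + 1) ζ = x) : b x = B.mkQ z := by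
    refine (Submodule.Quotient.eq B).mpr ?_
    change e (r + 1) (ξ x) - (z : Ω (r + 1 + 1)) ∈ Bmod d e (r + 1)
    rw [← hz, ← map_sub]
    refine coboundary _ ?_
    rw [map_sub, hξ, hζ, sub_self]
    exact zero_mem _
  let bZ : Zmod d e (r + 1 + 1) →ₗ[R] Emod d e (r + 1) :=
    { toFun := b
      map_add' := fun x y => by
        rw [b_eq (x + y) (⟨e (r + 1) (ξ x), cocycle x x.2 _ (hξ x)⟩ +
          ⟨e (r + 1) (ξ y), cocycle y y.2 _ (hξ y)⟩) (ξ x + ξ y) (by simp) (by simp [hξ]),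
          map_add]
      map_smul' := fun c x => by
        rw [b_eq (c • x) (c • ⟨e (r + 1) (ξ x), cocycle x x.2 _ (hξ x)⟩) (c • ξ x)
          (by simp) (by simp [hξ]), map_smul, RingHom.id_apply] }
  refine ⟨B.liftQ bZ fun x hx => ?_, fun x hx ζ hζ he => b_eq ⟨x, hx⟩ ⟨_, he⟩ ζ rfl hζ⟩
  refine (Submodule.Quotient.mk_eq_zero B).mpr (coboundary _ ?_)
  rw [hξ]
  exact hx
end

section
/- In the abstract setting, assume (Ω^•, d) is exact in positive degrees and let p ≥ 2. Let H^p(I^•, d) := (I^p ∩ ker d)/d(I^{p−1}). Then the map ∂ : H^p(I^•, d) → E^p, sending the class of an element y = e(w) (with w ∈ Ω^{p−1}, y ∈ I^p ∩ ker d) to the class of d(w) in E^p, is well defined (independent of the choice of w and of the representative y) and bijective. -/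
/-- For anticommuting differentials `d` and `e` with `d` exact in degree `r + 1`, two elements
`e w` and `e w'` differ by an element of `d (range e)` if and only if `d w` and `d w'` differ by an
element of `d (ker e)`. -/
theorem e_sub_e_mem_iff_d_sub_d_mem_Bmod
    {R : Type*} [CommRing R] {Ω : ℤ → Type*}
    [∀ i, AddCommGroup (Ω i)] [∀ i, Module R (Ω i)]
    (d e : ∀ i : ℤ, Ω i →ₗ[R] Ω (i + 1)) (r : ℤ)
    (hdd : ∀ x : Ω r, d (r + 1) (d r x) = 0)
    (hde : ∀ x : Ω r, d (r + 1) (e r x) = - e (r + 1) (d r x))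
    (hex : ∀ y : Ω (r + 1), d (r + 1) y = 0 → ∃ x : Ω r, d r x = y)
    (w w' : Ω (r + 1)) :
    e (r + 1) w - e (r + 1) w' ∈ Submodule.map (d (r + 1)) (LinearMap.range (e r)) ↔
      d (r + 1) w - d (r + 1) w' ∈ Bmod d e (r + 1) := by
  constructor
  · rintro ⟨_, ⟨u, rfl⟩, hu⟩
    refine ⟨w - w' + d r u, ?_, by simp [hdd]⟩
    rw [hde] at hu
    simp [← hu]
  · rintro ⟨k, hk, hdk⟩
    obtain ⟨u, hu⟩ := hex (w - w' - k) (by simp [hdk])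
    refine ⟨e r (-u), ⟨-u, rfl⟩, ?_⟩
    rw [hde, map_neg, map_neg, neg_neg, hu, map_sub, map_sub, LinearMap.mem_ker.mp hk, sub_zero]

/-- paper's Lemma "Tilde b": the connecting map
`∂^p : H^p(I^•) → H^p(K^•) = E^p` is an isomorphism for `p ≥ 2`; here
`p = r + 2` with `r ≥ 0`.  The map sending the class of `y = e(w)` (with
`y ∈ I^p ∩ ker d`) to the class of `d(w)` in `E^p` is well defined and
bijective. -/
theorem brieskorn_connecting_map_bijective
    {R : Type*} [CommRing R] {Ω : ℤ → Type*}
    [∀ i, AddCommGroup (Ω i)] [∀ i, Module R (Ω i)]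
    (hneg : ∀ i : ℤ, i < 0 → Subsingleton (Ω i))
    (d e : ∀ i : ℤ, Ω i →ₗ[R] Ω (i + 1))
    (hdd : ∀ (i : ℤ) (x : Ω i), d (i + 1) (d i x) = 0)
    (hee : ∀ (i : ℤ) (x : Ω i), e (i + 1) (e i x) = 0)
    (hde : ∀ (i : ℤ) (x : Ω i), d (i + 1) (e i x) = - e (i + 1) (d i x))
    (hex : ∀ i : ℤ, 0 ≤ i → ∀ y : Ω (i + 1), d (i + 1) y = 0 →
      ∃ x : Ω i, d i x = y)
    (r : ℤ) (hr : 0 ≤ r) :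
    ∃ del : (↥(LinearMap.range (e (r + 1)) ⊓ LinearMap.ker (d (r + 1 + 1))) ⧸
            Submodule.comap
              (LinearMap.range (e (r + 1)) ⊓ LinearMap.ker (d (r + 1 + 1))).subtype
              (Submodule.map (d (r + 1)) (LinearMap.range (e r)))) →
          Emod d e (r + 1),
      (∀ (w : Ω (r + 1))
          (hy : e (r + 1) w ∈
            LinearMap.range (e (r + 1)) ⊓ LinearMap.ker (d (r + 1 + 1)))
          (hd : d (r + 1) w ∈ Zmod d e (r + 1 + 1)),
        del (Submodule.Quotient.mk ⟨e (r + 1) w, hy⟩) =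
          Submodule.Quotient.mk ⟨d (r + 1) w, hd⟩) ∧
      Function.Bijective del := by
  have hdZ : ∀ w : Ω (r + 1), d (r + 1 + 1) (e (r + 1) w) = 0 →
      d (r + 1) w ∈ Zmod d e (r + 1 + 1) := fun w hw =>
    ⟨by rwa [hde, neg_eq_zero] at hw, hdd _ w⟩
  have key := e_sub_e_mem_iff_d_sub_d_mem_Bmod d e r (hdd r) (hde r) (hex r hr)
  have hlift : ∀ q : (↥(LinearMap.range (e (r + 1)) ⊓ LinearMap.ker (d (r + 1 + 1))) ⧸
      Submodule.comap
        (LinearMap.range (e (r + 1)) ⊓ LinearMap.ker (d (r + 1 + 1))).subtype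
        (Submodule.map (d (r + 1)) (LinearMap.range (e r)))),
      ∃ (w : Ω (r + 1)) (hw : d (r + 1 + 1) (e (r + 1) w) = 0),
        Submodule.Quotient.mk ⟨e (r + 1) w, ⟨w, rfl⟩, hw⟩ = q := by
    intro q
    obtain ⟨⟨_, ⟨w, rfl⟩, hw⟩, rfl⟩ := Submodule.Quotient.mk_surjective _ q
    exact ⟨w, hw, rfl⟩
  choose w hw hq using hlift
  have hdel : ∀ (v : Ω (r + 1))
      (hy : e (r + 1) v ∈ LinearMap.range (e (r + 1)) ⊓ LinearMap.ker (d (r + 1 + 1)))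
      (hd : d (r + 1) v ∈ Zmod d e (r + 1 + 1)),
      (Submodule.Quotient.mk ⟨d (r + 1) (w (Submodule.Quotient.mk ⟨e (r + 1) v, hy⟩)),
        hdZ _ (hw _)⟩ : Emod d e (r + 1)) = Submodule.Quotient.mk ⟨d (r + 1) v, hd⟩ :=
    fun v hy hd => (Submodule.Quotient.eq (Submodule.comap _ _)).mpr
      ((key _ v).mp ((Submodule.Quotient.eq (Submodule.comap _ _)).mp
        (hq (Submodule.Quotient.mk ⟨_, hy⟩))))
  refine ⟨fun q => Submodule.Quotient.mk ⟨d (r + 1) (w q), hdZ _ (hw q)⟩, hdel, ?_, ?_⟩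
  · intro q q' h
    rw [← hq q, ← hq q']
    exact (Submodule.Quotient.eq (Submodule.comap _ _)).mpr
      ((key _ _).mpr ((Submodule.Quotient.eq (Submodule.comap _ _)).mp h))
  · intro z
    obtain ⟨⟨z, hez, hdz⟩, rfl⟩ := Submodule.Quotient.mk_surjective _ z
    obtain ⟨v, rfl⟩ := hex (r + 1) (by lia) z hdz
    have hv : d (r + 1 + 1) (e (r + 1) v) = 0 := by
      rw [hde, LinearMap.mem_ker.mp hez, neg_zero]
    exact ⟨Submodule.Quotient.mk ⟨e (r + 1) v, ⟨v, rfl⟩, hv⟩, hdel v _ _⟩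
end

section
/- In the abstract setting, assume (Ω^•, d) is exact in positive degrees and let p ≥ 2. Then for every class c ∈ E^p one has H^p(u)(b c) = b (H^p(u) c), i.e. the map H^p(u) : E^p → ℰ^p intertwines the action of b on E^p with the shift-induced action of b on ℰ^p. -/
section UnitSeq

variable {R : Type*} [CommRing R] {Ω : ℤ → Type*}
  [∀ i, AddCommGroup (Ω i)] [∀ i, Module R (Ω i)]

theorem unitSeq_mem_ZSeq (d e : ∀ i : ℤ, Ω i →ₗ[R] Ω (i + 1)) {p : ℤ} {x : Ω p}
    (hx : x ∈ Zmod d e p) : unitSeq x ∈ ZSeq d e p := by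
  refine ⟨hx.1, LinearMap.mem_ker.2 (funext fun j => ?_)⟩
  have hd : d p x = 0 := hx.2
  cases j <;> simp [Dop, unitSeq, hd]

theorem bShift_mem_KSeq (e : ∀ i : ℤ, Ω i →ₗ[R] Ω (i + 1)) {p : ℤ} (X : ℕ → Ω p) :
    bShift X ∈ KSeq e p :=
  map_zero (e p)

theorem bShift_mem_ZSeq (d e : ∀ i : ℤ, Ω i →ₗ[R] Ω (i + 1)) {p : ℤ} {X : ℕ → Ω p}
    (hX : X ∈ ZSeq d e p) : bShift X ∈ ZSeq d e p := by
  refine ⟨bShift_mem_KSeq e X, LinearMap.mem_ker.2 (funext fun j => ?_)⟩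
  have he : e p (X 0) = 0 := hX.1
  cases j with
  | zero => simp [Dop, bShift, he]
  | succ k => exact congrFun (LinearMap.mem_ker.1 hX.2) k

theorem Dop_bShift_unitSeq (d e : ∀ i : ℤ, Ω i →ₗ[R] Ω (i + 1)) {p : ℤ} (ξ : Ω p) :
    Dop d e p (bShift (unitSeq ξ)) = bShift (unitSeq (d p ξ)) - unitSeq (e p ξ) := by
  funext j
  rcases j with _ | _ | k <;> simp [Dop, bShift, unitSeq]

end UnitSeq

/-- compatibility of `H^p(u)` with `b`, from the paper's
Propositions on `u⁰` and `u¹`.  Assume `(Ω^•, d)` is exact in positive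
degrees and `p ≥ 2` (here `p = r + 2` with `r ≥ 0`).  Then
`H^p(u)(b c) = b (H^p(u) c)` for every class `c ∈ E^p`. -/
theorem brieskorn_Hu_intertwines_b
    {R : Type*} [CommRing R] {Ω : ℤ → Type*}
    [∀ i, AddCommGroup (Ω i)] [∀ i, Module R (Ω i)]
    (hneg : ∀ i : ℤ, i < 0 → Subsingleton (Ω i))
    (d e : ∀ i : ℤ, Ω i →ₗ[R] Ω (i + 1))
    (hdd : ∀ (i : ℤ) (x : Ω i), d (i + 1) (d i x) = 0)
    (hee : ∀ (i : ℤ) (x : Ω i), e (i + 1) (e i x) = 0)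
    (hde : ∀ (i : ℤ) (x : Ω i), d (i + 1) (e i x) = - e (i + 1) (d i x))
    (hex : ∀ i : ℤ, 0 ≤ i → ∀ y : Ω (i + 1), d (i + 1) y = 0 →
      ∃ x : Ω i, d i x = y)
    (r : ℤ) (hr : 0 ≤ r)
    -- the action of `b` on `E^p`
    (bE : Emod d e (r + 1) →ₗ[R] Emod d e (r + 1))
    (hbE : ∀ (x : Ω (r + 1 + 1)) (hx : x ∈ Zmod d e (r + 1 + 1)) (ξ : Ω (r + 1))
        (hξ : d (r + 1) ξ = x) (he : e (r + 1) ξ ∈ Zmod d e (r + 1 + 1)),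
      bE (Submodule.Quotient.mk ⟨x, hx⟩) =
        Submodule.Quotient.mk ⟨e (r + 1) ξ, he⟩)
    -- the shift-induced action of `b` on `ℰ^p`
    (bcalE : ESeq d e (r + 1) →ₗ[R] ESeq d e (r + 1))
    (hbcalE : ∀ (X : ℕ → Ω (r + 1 + 1)) (hX : X ∈ ZSeq d e (r + 1 + 1))
        (hb : bShift X ∈ ZSeq d e (r + 1 + 1)),
      bcalE (Submodule.Quotient.mk ⟨X, hX⟩) =
        Submodule.Quotient.mk ⟨bShift X, hb⟩)
    -- the map `H^p(u) : E^p → ℰ^p` induced by `u : x ↦ (x,0,0,…)`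
    (Hu : Emod d e (r + 1) →ₗ[R] ESeq d e (r + 1))
    (hHu : ∀ (x : Ω (r + 1 + 1)) (hx : x ∈ Zmod d e (r + 1 + 1))
        (hu : unitSeq x ∈ ZSeq d e (r + 1 + 1)),
      Hu (Submodule.Quotient.mk ⟨x, hx⟩) =
        Submodule.Quotient.mk ⟨unitSeq x, hu⟩) :
    ∀ c : Emod d e (r + 1), Hu (bE c) = bcalE (Hu c) := by
  intro c
  obtain ⟨⟨x, hx⟩, rfl⟩ := Submodule.Quotient.mk_surjective _ c
  obtain ⟨ξ, rfl⟩ := hex (r + 1) (by omega) x hx.2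
  have heξ : e (r + 1) ξ ∈ Zmod d e (r + 1 + 1) := by
    refine ⟨hee _ ξ, LinearMap.mem_ker.2 ?_⟩
    rw [hde, LinearMap.mem_ker.1 hx.1, neg_zero]
  have hu := unitSeq_mem_ZSeq d e hx
  rw [hbE _ hx ξ rfl heξ, hHu _ heξ (unitSeq_mem_ZSeq d e heξ), hHu _ hx hu,
    hbcalE _ hu (bShift_mem_ZSeq d e hu)]
  refine Eq.symm ((Submodule.Quotient.eq _).2 ?_)
  exact ⟨bShift (unitSeq ξ), bShift_mem_KSeq e _, Dop_bShift_unitSeq d e ξ⟩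
end

section
/- In the abstract setting, assume (Ω^•, d) is exact in positive degrees and let p ≥ 2. If x ∈ K^p ∩ ker d and u(x) ∈ D(𝒦^{p−1}), then the class [x] ∈ E^p lies in b^m(E^p) for every m ∈ ℕ. In other words, the kernel of H^p(u) : E^p → ℰ^p is contained in ⋂_{m} b^m(E^p). -/
/-- first part of the paper's Proposition on the map `u¹`.
Assume `(Ω^•, d)` is exact in positive degrees and `p ≥ 2` (here `p = r + 2`
with `r ≥ 0`).  If `x ∈ K^p ∩ ker d` and `u(x) ∈ D(𝒦^{p-1})`, then the class
`[x] ∈ E^p` lies in `b^m(E^p)` for every `m`; that is, the kernel of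
`H^p(u) : E^p → ℰ^p` is contained in `⋂ₘ b^m(E^p)`. -/
theorem brieskorn_ker_Hu_subset_inter_b_pow
    {R : Type*} [CommRing R] {Ω : ℤ → Type*}
    [∀ i, AddCommGroup (Ω i)] [∀ i, Module R (Ω i)]
    (hneg : ∀ i : ℤ, i < 0 → Subsingleton (Ω i))
    (d e : ∀ i : ℤ, Ω i →ₗ[R] Ω (i + 1))
    (hdd : ∀ (i : ℤ) (x : Ω i), d (i + 1) (d i x) = 0)
    (hee : ∀ (i : ℤ) (x : Ω i), e (i + 1) (e i x) = 0)
    (hde : ∀ (i : ℤ) (x : Ω i), d (i + 1) (e i x) = - e (i + 1) (d i x))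
    (hex : ∀ i : ℤ, 0 ≤ i → ∀ y : Ω (i + 1), d (i + 1) y = 0 →
      ∃ x : Ω i, d i x = y)
    (r : ℤ) (hr : 0 ≤ r)
    -- the action of `b` on `E^p`
    (bE : Module.End R (Emod d e (r + 1)))
    (hbE : ∀ (x : Ω (r + 1 + 1)) (hx : x ∈ Zmod d e (r + 1 + 1)) (ξ : Ω (r + 1))
        (hξ : d (r + 1) ξ = x) (he : e (r + 1) ξ ∈ Zmod d e (r + 1 + 1)),
      bE (Submodule.Quotient.mk ⟨x, hx⟩) =
        Submodule.Quotient.mk ⟨e (r + 1) ξ, he⟩) :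
    ∀ (x : Ω (r + 1 + 1)) (hx : x ∈ Zmod d e (r + 1 + 1)),
      unitSeq x ∈ BSeq d e (r + 1) →
      ∀ m : ℕ,
        (Submodule.Quotient.mk ⟨x, hx⟩ : Emod d e (r + 1)) ∈
          LinearMap.range (bE ^ m) := by
  rintro x hx ⟨ω, hω, hD⟩ m
  have h0 : e (r + 1) (ω 0) = 0 := hω
  have hx0 : d (r + 1) (ω 0) - e (r + 1) (ω 1) = x := congrFun hD 0
  have hsucc : ∀ j, d (r + 1) (ω (j + 1)) = e (r + 1) (ω (j + 2)) := fun j =>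
    sub_eq_zero.mp (congrFun hD (j + 1))
  have hZ : ∀ j, e (r + 1) (ω (j + 1)) ∈ Zmod d e (r + 1 + 1) := fun j =>
    ⟨hee _ _, by rw [SetLike.mem_coe, LinearMap.mem_ker, hde, hsucc, hee, neg_zero]⟩
  have hb : ∀ j, bE (Submodule.Quotient.mk ⟨e (r + 1) (ω (j + 2)), hZ (j + 1)⟩) =
      Submodule.Quotient.mk ⟨e (r + 1) (ω (j + 1)), hZ j⟩ := fun j =>
    hbE _ _ _ (hsucc j) _
  have hpow : (bE ^ m) (Submodule.Quotient.mk ⟨e (r + 1) (ω (m + 1)), hZ m⟩) =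
      Submodule.Quotient.mk ⟨e (r + 1) (ω 1), hZ 0⟩ := by
    induction m with
    | zero => rfl
    | succ k ih => rw [pow_succ, Module.End.mul_apply, hb, ih]
  refine ⟨-Submodule.Quotient.mk ⟨e (r + 1) (ω (m + 1)), hZ m⟩, ?_⟩
  rw [map_neg, hpow, ← Submodule.Quotient.mk_neg, eq_comm, Submodule.Quotient.eq]
  refine ⟨ω 0, h0, ?_⟩
  simp [← hx0]
end

section
/- In the abstract setting, assume (Ω^•, d) is exact in positive degrees, let p ≥ 1, and assume ⋂_{m} b^m(E^{p+1}) = {0} (where b is the induced endomorphism of E^{p+1}). Then for every X ∈ 𝒦^p with D X = 0 and every N ∈ ℕ there exists Y ∈ 𝒦^{0,p} with D Y = 0 such that the components of X − Y of index < N all vanish (i.e. X − Y ∈ b^N(𝒦^p)). -/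
/-- density statement of the paper's Proposition on `u¹`.
Assume `(Ω^•, d)` is exact in positive degrees, `p ≥ 1` (here `p = q + 1`
with `q ≥ 0`), and `⋂ₘ b^m(E^{p+1}) = 0`.  Then for every `X ∈ 𝒦^p` with
`D X = 0` and every `N` there is a `D`-closed `Y ∈ 𝒦^{0,p}` such that the
components of `X - Y` of index `< N` all vanish. -/
theorem brieskorn_image_u1_b_adically_dense
    {R : Type*} [CommRing R] {Ω : ℤ → Type*}
    [∀ i, AddCommGroup (Ω i)] [∀ i, Module R (Ω i)]
    (hneg : ∀ i : ℤ, i < 0 → Subsingleton (Ω i))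
    (d e : ∀ i : ℤ, Ω i →ₗ[R] Ω (i + 1))
    (hdd : ∀ (i : ℤ) (x : Ω i), d (i + 1) (d i x) = 0)
    (hee : ∀ (i : ℤ) (x : Ω i), e (i + 1) (e i x) = 0)
    (hde : ∀ (i : ℤ) (x : Ω i), d (i + 1) (e i x) = - e (i + 1) (d i x))
    (hex : ∀ i : ℤ, 0 ≤ i → ∀ y : Ω (i + 1), d (i + 1) y = 0 →
      ∃ x : Ω i, d i x = y)
    (q : ℤ) (hq : 0 ≤ q)
    -- the action of `b` on `E^{p+1}`
    (bE : Module.End R (Emod d e (q + 1)))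
    (hbE : ∀ (x : Ω (q + 1 + 1)) (hx : x ∈ Zmod d e (q + 1 + 1)) (ξ : Ω (q + 1))
        (hξ : d (q + 1) ξ = x) (he : e (q + 1) ξ ∈ Zmod d e (q + 1 + 1)),
      bE (Submodule.Quotient.mk ⟨x, hx⟩) =
        Submodule.Quotient.mk ⟨e (q + 1) ξ, he⟩)
    -- the assumption `⋂ₘ b^m(E^{p+1}) = {0}`
    (hsep : (⨅ m : ℕ, LinearMap.range (bE ^ m)) = ⊥) :
    ∀ X ∈ KSeq e (q + 1), Dop d e (q + 1) X = 0 →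
      ∀ N : ℕ, ∃ Y : ℕ → Ω (q + 1),
        Y ∈ KSeq e (q + 1) ∧ Y ∈ finSuppSeq (R := R) (q + 1) ∧
        Dop d e (q + 1) Y = 0 ∧ ∀ j : ℕ, j < N → X j = Y j := by
  intro X hX hD N
  have hdX (j : ℕ) : d (q + 1) (X j) = e (q + 1) (X (j + 1)) := sub_eq_zero.mp (congrFun hD j)
  have heX : e (q + 1) (X 0) = 0 := hX
  have hZ (j : ℕ) : d (q + 1) (X j) ∈ Zmod d e (q + 1 + 1) :=
    Submodule.mem_inf.mpr ⟨by rw [LinearMap.mem_ker, hdX, hee], by rw [LinearMap.mem_ker, hdd]⟩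
  let c : ℕ → Emod d e (q + 1) := fun j => Submodule.Quotient.mk ⟨d (q + 1) (X j), hZ j⟩
  have hc (j : ℕ) : bE (c (j + 1)) = c j := by
    refine (hbE _ (hZ (j + 1)) (X (j + 1)) rfl (hdX j ▸ hZ j)).trans ?_
    congr 2
    exact (hdX j).symm
  have hpow (m j : ℕ) : (bE ^ m) (c (j + m)) = c j := by
    induction m with
    | zero => rfl
    | succ m ih => rw [pow_succ, Module.End.mul_apply, ← add_assoc, hc, ih]
  have hcN : c N = 0 := by
    rw [← Submodule.mem_bot R, ← hsep, Submodule.mem_iInf]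
    exact fun m => ⟨_, hpow m N⟩
  obtain ⟨κ, hκ, hdκ⟩ : ∃ κ : Ω (q + 1), e (q + 1) κ = 0 ∧ d (q + 1) κ = d (q + 1) (X N) :=
    (Submodule.Quotient.mk_eq_zero _).mp hcN
  refine ⟨fun j => if j < N then X j else if j = N then X N - κ else 0, ?_,
    ⟨N + 1, fun j hj => ?_⟩, ?_, fun j hj => (if_pos hj).symm⟩
  · change e (q + 1) (if 0 < N then X 0 else if 0 = N then X N - κ else 0) = 0
    split_ifs with h h'
    · exact heX
    · subst h'
      rw [map_sub, heX, hκ, sub_zero]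
    · exact map_zero _
  · exact (if_neg (by lia)).trans (if_neg (by lia))
  · funext j
    change d (q + 1) (if j < N then X j else if j = N then X N - κ else 0) -
      e (q + 1) (if j + 1 < N then X (j + 1) else if j + 1 = N then X N - κ else 0) = 0
    rcases lt_trichotomy (j + 1) N with h | h | h
    · rw [if_pos (by lia), if_pos h, hdX, sub_self]
    · subst h
      rw [if_pos (by lia), if_neg (by lia), if_pos rfl, map_sub, hκ, hdX, sub_zero, sub_self]
    · rw [if_neg (by lia), if_neg (by lia : ¬ j + 1 < N), if_neg (by lia : ¬ j + 1 = N), map_zero,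
        sub_zero]
      split_ifs with h'
      · rw [map_sub, hdκ, sub_self]
      · exact map_zero _
end
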